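/- arXiv:2308.00948 — 4 statements merged into one kernel-verified Lean document; each statement's English description precedes it below -/
import Mathlib

section
/- Let n ≥ 3, let k be an integer with 2 ≤ k ≤ n, and let τ ∈ (0, 2(n−1)/n). Let A be an n×n real symmetric matrix, write R = trace(A), and set A^τ = A − (τR/(2(n−1)))·Iₙ. If the vector of eigenvalues of A^τ lies in the closed cone Γ̄_k (that is, σ_j of the eigenvalues of A^τ is ≥ 0 for all 1 ≤ j ≤ k), then the matrix A − [(2k − (2−τ)n)/(2n(k−1))]·R·Iₙ is positive semidefinite. -/
/-- The `j`-th elementary symmetric polynomial of the entries of `Λ : Fin n → ℝ`. -/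
noncomputable def esymm {n : ℕ} (j : ℕ) (Λ : Fin n → ℝ) : ℝ :=
  ∑ s ∈ Finset.univ.powersetCard j, ∏ i ∈ s, Λ i

open Polynomial in
/-- Newton's inequality `k² eₖ ≤ e₁ eₖ₋₁` for `k` positive numbers, read off from the lowest two
coefficients of `∏ (X + a)`. -/
lemma sq_card_mul_coeff_zero_le (s : Multiset ℝ) (hs : ∀ a ∈ s, 0 < a) :
    0 < (s.map fun a => X + C a).prod.coeff 0 ∧ 0 ≤ (s.map fun a => X + C a).prod.coeff 1 ∧
    (s.card : ℝ) ^ 2 * (s.map fun a => X + C a).prod.coeff 0 ≤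
      s.sum * (s.map fun a => X + C a).prod.coeff 1 := by
  induction s using Multiset.induction with
  | empty => simp [coeff_one]
  | cons a s ih =>
    obtain ⟨hP, hF, h⟩ := ih fun b hb => hs b (Multiset.mem_cons_of_mem hb)
    have ha : 0 < a := hs a (Multiset.mem_cons_self a s)
    have hS : 0 ≤ s.sum := Multiset.sum_nonneg fun b hb =>
      (hs b (Multiset.mem_cons_of_mem hb)).le
    simp only [Multiset.map_cons, Multiset.prod_cons, Multiset.card_cons, Multiset.sum_cons]
    generalize (s.map fun a => X + C a).prod = q at *
    have h0 : ((X + C a) * q).coeff 0 = a * q.coeff 0 := by simp [mul_coeff_zero]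
    have h1 : ((X + C a) * q).coeff 1 = q.coeff 0 + a * q.coeff 1 := by
      rw [add_mul, coeff_add, coeff_C_mul, coeff_X_mul]
    rw [h0, h1]
    refine ⟨by positivity, by positivity, ?_⟩
    push_cast
    generalize q.coeff 0 = P at *
    generalize q.coeff 1 = F at *
    generalize s.sum = S at *
    generalize (s.card : ℝ) = k at *
    have key : 2 * a * k * P ≤ S * P + a ^ 2 * F := by
      refine le_of_sq_le_sq ?_ (by positivity)
      have := mul_le_mul_of_nonneg_left h (by positivity : 0 ≤ 4 * a ^ 2 * P)
      nlinarith [sq_nonneg (S * P - a ^ 2 * F)]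
    nlinarith

open Polynomial in
lemma eval_pos_of_coeff_pos {p : ℝ[X]} (hp : ∀ i ≤ p.natDegree, 0 < p.coeff i) {x : ℝ}
    (hx : 0 ≤ x) : 0 < p.eval x := by
  rw [eval_eq_sum_range, Finset.sum_range_succ']
  have h0 := hp 0 (Nat.zero_le _)
  have : 0 ≤ ∑ i ∈ Finset.range p.natDegree, p.coeff (i + 1) * x ^ (i + 1) :=
    Finset.sum_nonneg fun i hi =>
      mul_nonneg (hp _ (by simpa using hi)).le (pow_nonneg hx _)
  simpa using by linarith

open Polynomial in
lemma Polynomial.Splits.sq_natDegree_mul_coeff_le {p : ℝ[X]} (hs : p.Splits) {l : ℕ}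
    (hd : p.natDegree = l + 1) (hp : ∀ i ≤ l + 1, 0 < p.coeff i) :
    ((l : ℝ) + 1) ^ 2 * p.coeff 0 * p.coeff (l + 1) ≤ p.coeff l * p.coeff 1 := by
  set s : Multiset ℝ := p.roots.map Neg.neg with hsdef
  have hcard : s.card = l + 1 := by
    rw [hsdef, Multiset.card_map, splits_iff_card_roots.1 hs, hd]
  have hpos : ∀ a ∈ s, 0 < a := by
    intro a ha
    obtain ⟨r, hr, rfl⟩ := Multiset.mem_map.1 ha
    by_contra! hneg
    have h0 := eval_pos_of_coeff_pos (fun i hi => hp i (hd ▸ hi)) (by linarith : 0 ≤ r)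
    have := (mem_roots'.1 hr).2
    rw [IsRoot.def] at this
    linarith
  have hprod : p = C (p.coeff (l + 1)) * (s.map fun a => X + C a).prod := by
    conv_lhs => rw [hs.eq_prod_roots]
    rw [leadingCoeff, hd, hsdef, Multiset.map_map]
    congr 3
    funext x
    simp [sub_eq_add_neg]
  obtain ⟨-, -, h⟩ := sq_card_mul_coeff_zero_le s hpos
  have hl : (s.map fun a => X + C a).prod.coeff l = s.sum := by
    rw [Multiset.prod_X_add_C_coeff s (by omega), hcard, Nat.add_sub_cancel_left,
      Multiset.esymm, Multiset.powersetCard_one, Multiset.map_map]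
    simp
  have hc : ∀ i, p.coeff i = p.coeff (l + 1) * (s.map fun a => X + C a).prod.coeff i := by
    intro i
    conv_lhs => rw [hprod, coeff_C_mul]
  rw [hc 0, hc l, hc 1, hl]
  rw [hcard] at h
  push_cast at h
  have := mul_le_mul_of_nonneg_left h (sq_nonneg (p.coeff (l + 1)))
  nlinarith

open Polynomial in
lemma Polynomial.Splits.derivative_of_real {p : ℝ[X]} (hs : p.Splits) : p.derivative.Splits := by
  rw [splits_iff_card_roots] at *
  refine le_antisymm (card_roots' _) ?_
  have := card_roots_le_derivative p
  have := natDegree_derivative_le p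
  omega

open Polynomial in
/-- In terms of the elementary symmetric functions of `m = d + l + 1` numbers with
`σ₁, …, σₖ > 0` and `k = l + 1`, this is `k m σₖ ≤ (m - k + 1) σ₁ σₖ₋₁`. -/
lemma Polynomial.Splits.mul_coeff_le_of_coeff_pos (l d : ℕ) :
    ∀ {p : ℝ[X]}, p.Splits → p.natDegree = d + l + 1 →
    (∀ i, d ≤ i → i ≤ d + l + 1 → 0 < p.coeff i) →
    ((l : ℝ) + 1) * (d + l + 1) * p.coeff d * p.coeff (d + l + 1) ≤
      (d + 1) * p.coeff (d + l) * p.coeff (d + 1) := by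
  induction d with
  | zero =>
    intro p hs hd hp
    rw [Nat.zero_add] at hd
    have := hs.sq_natDegree_mul_coeff_le hd fun i hi => hp i (Nat.zero_le _) (by omega)
    simp only [Nat.zero_add, CharP.cast_eq_zero]
    linarith
  | succ d ih =>
    intro p hs hd hp
    have h := ih hs.derivative_of_real (by rw [natDegree_derivative, hd]; omega) fun i h1 h2 => by
      rw [coeff_derivative]
      exact mul_pos (hp _ (by omega) (by omega)) (by positivity)
    simp only [coeff_derivative] at h
    rw [show d + 1 + l + 1 = d + l + 1 + 1 by ring, show d + 1 + l = d + l + 1 by ring]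
    push_cast at h ⊢
    refine le_of_mul_le_mul_left ?_ (by positivity : (0 : ℝ) < (d + 1) * (d + l + 1))
    linarith

lemma esymm_eq_coeff {n : ℕ} (Λ : Fin n → ℝ) {j : ℕ} (hj : j ≤ n) :
    esymm j Λ = (∏ i, (Polynomial.X + Polynomial.C (Λ i))).coeff (n - j) := by
  rw [Finset.prod_X_add_C_coeff _ _ (by simp)]
  simp [esymm, Nat.sub_sub_self hj]

lemma esymm_one {n : ℕ} (Λ : Fin n → ℝ) : esymm 1 Λ = ∑ i, Λ i := by
  simp [esymm, Finset.powersetCard_one]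

open Polynomial in
/-- Every entry of a vector in the closed cone `Γ̄ₖ` is bounded below by
`-(n - k) / (n (k - 1))` times the sum of the entries. -/
lemma neg_mul_sum_le_of_esymm_nonneg {n k : ℕ} (hk1 : 2 ≤ k) (hk2 : k ≤ n) (Λ : Fin n → ℝ)
    (hΓ : ∀ j : ℕ, 1 ≤ j → j ≤ k → 0 ≤ esymm j Λ) (i : Fin n) :
    -(((n : ℝ) - k) * ∑ i, Λ i) ≤ n * (k - 1) * Λ i := by
  have hS : 0 ≤ ∑ i, Λ i := esymm_one Λ ▸ hΓ 1 le_rfl (by omega)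
  have hk2' : (k : ℝ) ≤ n := by exact_mod_cast hk2
  have hk1' : (2 : ℝ) ≤ k := by exact_mod_cast hk1
  rcases le_or_gt 0 (Λ i) with hi | hi
  · have : 0 ≤ ((n : ℝ) - k) * ∑ i, Λ i := mul_nonneg (by linarith) hS
    have : 0 ≤ (n : ℝ) * (k - 1) * Λ i :=
      mul_nonneg (mul_nonneg (by linarith) (by linarith)) hi
    linarith
  obtain ⟨a, ha⟩ : ∃ a, a = -Λ i := ⟨_, rfl⟩
  have ha0 : 0 < a := by linarith
  obtain ⟨m, rfl⟩ : ∃ m, n = m + 1 := ⟨n - 1, by omega⟩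
  set Q : ℝ[X] := ∏ j ∈ Finset.univ.erase i, (X + C (Λ j)) with hQ
  have hQs : Q.Splits := Splits.prod fun j _ => Splits.X_add_C _
  have hQd : Q.natDegree = m := by
    rw [hQ, natDegree_prod_of_monic _ _ fun j _ => monic_X_add_C _]
    simp
  have hQm : Q.coeff m = 1 := by
    have : Q.Monic := monic_prod_of_monic _ _ fun j _ => monic_X_add_C _
    rw [← hQd]
    exact this
  have hPQ : ∏ j, (X + C (Λ j)) = (X + C (Λ i)) * Q :=
    (Finset.mul_prod_erase _ _ (Finset.mem_univ i)).symm
  have hrec : ∀ j, j + 1 ≤ k → j + 1 ≤ m →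
      a * Q.coeff (m - j) ≤ Q.coeff (m - (j + 1)) := by
    intro j hj hjm
    have h := hΓ (j + 1) (by omega) hj
    rw [esymm_eq_coeff Λ (by omega), hPQ, show m + 1 - (j + 1) = m - (j + 1) + 1 by omega,
      add_mul, coeff_add, coeff_X_mul, coeff_C_mul,
      show m - (j + 1) + 1 = m - j by omega] at h
    rw [ha]
    linarith
  have hpos : ∀ j, j ≤ k → j ≤ m → 0 < Q.coeff (m - j) := by
    intro j
    induction j with
    | zero => intros; simp [hQm]
    | succ j ih =>
      intro h1 h2
      exact (mul_pos ha0 (ih (by omega) (by omega))).trans_le (hrec j h1 h2)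
  have hkm : k ≤ m := by
    by_contra! hlt
    obtain rfl : k = m + 1 := by omega
    have h := hΓ (m + 1) (by omega) le_rfl
    rw [esymm_eq_coeff Λ le_rfl, hPQ, Nat.sub_self, mul_coeff_zero] at h
    have h0 := hpos m (by omega) le_rfl
    rw [Nat.sub_self] at h0
    simp only [coeff_add, coeff_X_zero, coeff_C_zero, zero_add] at h
    nlinarith
  have hsum : ∑ j, Λ j = Q.coeff (m - 1) - a := by
    rw [← esymm_one, esymm_eq_coeff Λ (by omega), hPQ, Nat.add_sub_cancel]
    obtain ⟨r, rfl⟩ : ∃ r, m = r + 1 := ⟨m - 1, by omega⟩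
    rw [add_mul, coeff_add, coeff_X_mul, coeff_C_mul, hQm, ha, Nat.add_sub_cancel]
    ring
  obtain ⟨l, rfl⟩ : ∃ l, k = l + 1 := ⟨k - 1, by omega⟩
  obtain ⟨d, rfl⟩ : ∃ d, m = d + l + 1 := ⟨m - (l + 1), by omega⟩
  have hN := hQs.mul_coeff_le_of_coeff_pos l d hQd fun i h1 h2 => by
    have := hpos (d + l + 1 - i) (by omega) (by omega)
    rwa [show d + l + 1 - (d + l + 1 - i) = i by omega] at this
  have hr := hrec l le_rfl (by omega)
  have hp := hpos l (by omega) (by omega)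
  rw [show d + l + 1 - l = d + 1 by omega] at hr hp
  rw [show d + l + 1 - (l + 1) = d by omega] at hr
  rw [hQm, mul_one] at hN
  rw [show d + l + 1 - 1 = d + l by omega] at hsum
  have hle : ((l : ℝ) + 1) * (d + l + 1) * a ≤ (d + 1) * Q.coeff (d + l) := by
    refine le_of_mul_le_mul_right ?_ hp
    have := mul_le_mul_of_nonneg_left hr (by positivity : 0 ≤ ((l : ℝ) + 1) * (d + l + 1))
    linarith
  rw [hsum, show Λ i = -a by linarith]
  push_cast
  linarith

lemma Matrix.IsHermitian.posSemidef_add_smul_one {ι : Type*} [Fintype ι] [DecidableEq ι]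
    {B : Matrix ι ι ℝ} (hB : B.IsHermitian) (c : ℝ) (h : ∀ i, 0 ≤ hB.eigenvalues i + c) :
    (B + c • (1 : Matrix ι ι ℝ)).PosSemidef := by
  have hC : (B + c • (1 : Matrix ι ι ℝ)).IsHermitian :=
    hB.add (by simp [Matrix.IsHermitian])
  rw [hC.posSemidef_iff_eigenvalues_nonneg]
  intro i
  have hi := hC.eigenvalues_mem_spectrum_real i
  have : hC.eigenvalues i - c ∈ spectrum ℝ B := by
    rw [sub_eq_add_neg, spectrum.add_mem_iff]
    simpa [Algebra.algebraMap_eq_smul_one, add_comm] using hi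
  rw [hB.spectrum_real_eq_range_eigenvalues] at this
  obtain ⟨j, hj⟩ := this
  have := h j
  simp only [Pi.zero_apply]
  linarith


/-- Pointwise algebraic content of "`A^τ_g ∈ Γ̄ₖ` implies Ricci
pinching": if the eigenvalues of the modified tensor `A^τ = A - (τ R/(2(n-1))) Iₙ`
lie in the closed cone `Γ̄ₖ`, then `A - ((2k-(2-τ)n)/(2n(k-1))) R Iₙ` is
positive semidefinite, where `R = trace A`. -/
theorem stmt3 {n : ℕ} (hn : 3 ≤ n) (k : ℕ) (hk1 : 2 ≤ k) (hk2 : k ≤ n)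
    (τ : ℝ) (hτ0 : 0 < τ) (hτ1 : τ < 2 * (n - 1) / n)
    (A : Matrix (Fin n) (Fin n) ℝ) (hA : A.IsSymm)
    (hAτ : (A - (τ * A.trace / (2 * (n - 1))) •
      (1 : Matrix (Fin n) (Fin n) ℝ)).IsHermitian)
    (hΓ : ∀ j : ℕ, 1 ≤ j → j ≤ k → 0 ≤ esymm j hAτ.eigenvalues) :
    (A - (((2 * k - (2 - τ) * n) / (2 * n * (k - 1))) * A.trace) •
      (1 : Matrix (Fin n) (Fin n) ℝ)).PosSemidef := by
  have hn' : (3 : ℝ) ≤ n := by exact_mod_cast hn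
  have hk' : (2 : ℝ) ≤ k := by exact_mod_cast hk1
  have hsum : ∑ i, hAτ.eigenvalues i = A.trace - τ * A.trace / (2 * (n - 1)) * n := by
    have := hAτ.trace_eq_sum_eigenvalues
    simp only [RCLike.ofReal_real_eq_id, id_eq] at this
    rw [← this]
    simp [Matrix.trace_sub, Matrix.trace_smul]
  have hshift : A - (((2 * k - (2 - τ) * n) / (2 * n * (k - 1))) * A.trace) •
      (1 : Matrix (Fin n) (Fin n) ℝ) =
      (A - (τ * A.trace / (2 * (n - 1))) • (1 : Matrix (Fin n) (Fin n) ℝ)) +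
      (τ * A.trace / (2 * (n - 1)) - ((2 * k - (2 - τ) * n) / (2 * n * (k - 1))) * A.trace) •
      (1 : Matrix (Fin n) (Fin n) ℝ) := by
    rw [sub_smul]
    abel
  rw [hshift]
  refine hAτ.posSemidef_add_smul_one _ fun i => ?_
  have hΛ := neg_mul_sum_le_of_esymm_nonneg hk1 hk2 _ hΓ i
  have hn0 : (n : ℝ) ≠ 0 := by linarith
  have hn1 : (n : ℝ) - 1 ≠ 0 := by linarith
  have hk0 : (k : ℝ) - 1 ≠ 0 := by linarith
  have hpos : (0 : ℝ) < n * (k - 1) := mul_pos (by linarith) (by linarith)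
  have hc : n * (k - 1) * (τ * A.trace / (2 * (n - 1)) -
      ((2 * k - (2 - τ) * n) / (2 * n * (k - 1))) * A.trace) =
      ((n : ℝ) - k) * (A.trace - τ * A.trace / (2 * (n - 1)) * n) := by
    field_simp
    ring
  rw [hsum, ← hc] at hΛ
  refine nonneg_of_mul_nonneg_right ?_ hpos
  linarith
end

section
/- Let n ≥ 2, let k be an integer with 2 ≤ k ≤ n, and fix μ ∈ (0, 1/n). Set δ = (μ·n·(n−1) − (n−k))/(k − n·μ), a = 1 − μ·(n−1+δ), and b = δ − μ·(n−1+δ). Then the vector S₀ ∈ ℝⁿ whose first n−1 entries equal a and whose last entry equals b satisfies: (i) σ_k(S₀) = 0; (ii) σ_j(S₀) ≥ 0 for all 1 ≤ j ≤ k (so S₀ lies on the boundary of the cone Γ_k); and (iii) a > 0 and b < a. -/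
theorem Finset.sum_powersetCard_succ_insert_prod {ι R : Type*} [DecidableEq ι] [CommSemiring R]
    {x : ι} {t : Finset ι} (hx : x ∉ t) (j : ℕ) (f : ι → R) :
    ∑ s ∈ (insert x t).powersetCard (j + 1), ∏ i ∈ s, f i =
      ∑ s ∈ t.powersetCard (j + 1), ∏ i ∈ s, f i +
        f x * ∑ s ∈ t.powersetCard j, ∏ i ∈ s, f i := by
  have hmem : ∀ {r : ℕ} {s : Finset ι}, s ∈ t.powersetCard r → x ∉ s := fun hs h =>
    hx ((Finset.mem_powersetCard.1 hs).1 h)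
  rw [Finset.powersetCard_succ_insert hx, Finset.sum_union, Finset.sum_image, Finset.mul_sum]
  · congr 1
    exact Finset.sum_congr rfl fun s hs => Finset.prod_insert (hmem hs)
  · intro s hs s' hs' h
    rw [← Finset.erase_insert (hmem hs), ← Finset.erase_insert (hmem hs')]
    exact congrArg (fun u => Finset.erase u x) h
  · rw [Finset.disjoint_left]
    intro s hs h
    obtain ⟨u, -, rfl⟩ := Finset.mem_image.1 h
    exact hmem hs (Finset.mem_insert_self x u)

theorem Finset.sum_powersetCard_prod_of_eq {ι R : Type*} [CommSemiring R]
    {t : Finset ι} {f : ι → R} {a : R} (hf : ∀ i ∈ t, f i = a) (j : ℕ) :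
    ∑ s ∈ t.powersetCard j, ∏ i ∈ s, f i = t.card.choose j * a ^ j := by
  rw [Finset.sum_congr rfl (g := fun _ => a ^ j), Finset.sum_const, Finset.card_powersetCard,
    nsmul_eq_mul]
  intro s hs
  obtain ⟨hst, rfl⟩ := Finset.mem_powersetCard.1 hs
  exact Finset.prod_eq_pow_card fun i hi => hf i (hst hi)

theorem esymm_succ_of_last {m : ℕ} (j : ℕ) (a b : ℝ) :
    esymm (j + 1) (fun i : Fin (m + 1) => if (i : ℕ) = m then b else a) =
      m.choose (j + 1) * a ^ (j + 1) + b * (m.choose j * a ^ j) := by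
  have hf : ∀ i ∈ Finset.univ.erase (Fin.last m), (if (i : ℕ) = m then b else a) = a := by
    intro i hi
    exact if_neg fun h => (Finset.mem_erase.1 hi).1 (Fin.ext h)
  have hc : (Finset.univ.erase (Fin.last m)).card = m := by simp
  rw [esymm, ← Finset.insert_erase (Finset.mem_univ (Fin.last m)),
    Finset.sum_powersetCard_succ_insert_prod (Finset.notMem_erase _ _),
    Finset.sum_powersetCard_prod_of_eq hf, Finset.sum_powersetCard_prod_of_eq hf, hc]
  simp

theorem succ_mul_esymm_succ_of_last {m j : ℕ} (hj : j ≤ m) (a b : ℝ) :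
    (j + 1) * esymm (j + 1) (fun i : Fin (m + 1) => if (i : ℕ) = m then b else a) =
      m.choose j * a ^ j * ((m - j) * a + (j + 1) * b) := by
  have h : (m.choose (j + 1) : ℝ) * (j + 1) = m.choose j * (m - j) := by
    rw [← Nat.cast_sub hj]
    exact_mod_cast Nat.choose_succ_right_eq m j
  rw [esymm_succ_of_last]
  linear_combination a ^ (j + 1) * h

/-- The boundary model vector: with
`δ = (μn(n-1)-(n-k))/(k-nμ)`, `a = 1-μ(n-1+δ)`, `b = δ-μ(n-1+δ)`, the vector
with `n-1` entries `a` and last entry `b` satisfies `σₖ = 0`, `σⱼ ≥ 0` for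
`1 ≤ j ≤ k`, `a > 0` and `b < a`. -/
theorem stmt4 {n : ℕ} (hn : 2 ≤ n) (k : ℕ) (hk1 : 2 ≤ k) (hk2 : k ≤ n)
    (μ : ℝ) (hμ0 : 0 < μ) (hμ1 : μ < 1 / n)
    (δ a b : ℝ)
    (hδ : δ = (μ * n * (n - 1) - (n - k)) / (k - n * μ))
    (ha : a = 1 - μ * (n - 1 + δ)) (hb : b = δ - μ * (n - 1 + δ))
    (S₀ : Fin n → ℝ) (hS₀ : S₀ = fun i : Fin n => if (i : ℕ) = n - 1 then b else a) :
    esymm k S₀ = 0 ∧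
      (∀ j : ℕ, 1 ≤ j → j ≤ k → 0 ≤ esymm j S₀) ∧
      0 < a ∧ b < a := by
  obtain ⟨m, rfl⟩ : ∃ m, n = m + 1 := ⟨n - 1, by omega⟩
  simp only [Nat.add_sub_cancel] at hS₀
  have hn0 : (0 : ℝ) < (m + 1 : ℕ) := by positivity
  have hnμ : (m + 1 : ℕ) * μ < 1 := by
    rw [lt_div_iff₀ hn0] at hμ1
    linarith
  have hk : (2 : ℝ) ≤ k := by exact_mod_cast hk1
  push_cast at hδ ha hb hnμ hn0
  have hd : (0 : ℝ) < k - (m + 1) * μ := by linarith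
  obtain ⟨c, hc⟩ : ∃ c : ℝ, c = (1 - (m + 1) * μ) / (k - (m + 1) * μ) := ⟨_, rfl⟩
  have hc0 : 0 < c := hc ▸ div_pos (by linarith) hd
  rw [eq_div_iff hd.ne'] at hδ hc
  have ha' : a = k * c := by
    rw [ha]
    apply mul_right_cancel₀ hd.ne'
    linear_combination -μ * hδ - k * hc
  have hb' : b = (k - (m + 1)) * c := by
    rw [hb]
    apply mul_right_cancel₀ hd.ne'
    linear_combination (1 - μ) * hδ - (k - (m + 1)) * hc
  have ha0 : 0 < a := by rw [ha']; positivity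
  have key : ∀ j ≤ m, (j + 1) * esymm (j + 1) S₀ =
      m.choose j * a ^ j * ((m + 1) * c * (k - (j + 1))) := by
    intro j hj
    rw [hS₀, succ_mul_esymm_succ_of_last hj, ha', hb']
    ring
  refine ⟨?_, ?_, ha0, ?_⟩
  · obtain ⟨j, rfl⟩ : ∃ j, k = j + 1 := ⟨k - 1, by omega⟩
    have h := key j (by omega)
    rw [Nat.cast_succ, sub_self, mul_zero, mul_zero] at h
    exact (mul_eq_zero.1 h).resolve_left (by positivity)
  · intro j hj1 hjk
    obtain ⟨j, rfl⟩ : ∃ i, j = i + 1 := ⟨j - 1, by omega⟩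
    have hj : (0 : ℝ) ≤ k - (j + 1) := sub_nonneg.2 (by exact_mod_cast hjk)
    refine nonneg_of_mul_nonneg_right (a := (j + 1 : ℝ)) ?_ (by positivity)
    rw [key j (by omega)]
    positivity
  · rw [ha', hb']
    nlinarith
end

section
/- Let n ≥ 2, let k be an integer with 2 ≤ k ≤ n, and let a, b ∈ ℝ with a > 0 and a > b. Let S₀ ∈ ℝⁿ be the vector with n−1 entries equal to a and one entry equal to b, and suppose σ_j(S₀) ≥ 0 for all 1 ≤ j ≤ k and σ_k(S₀) = 0. Then every vector S ∈ ℝⁿ with σ_j(S) ≥ 0 for all 1 ≤ j ≤ k and with σ₁(S) = (n−1)a + b satisfies minᵢ Sᵢ ≥ b. -/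
open Polynomial in
theorem Polynomial.Splits.derivative_real {p : ℝ[X]} (hp : p.Splits) : p.derivative.Splits := by
  have hroots := splits_iff_card_roots.mp hp
  rw [splits_iff_card_roots]
  apply le_antisymm (card_roots' _)
  have h1 := card_roots_le_derivative p
  have h2 := natDegree_derivative_le p
  omega

open Polynomial in
theorem Polynomial.Splits.iterate_derivative_real {p : ℝ[X]} (hp : p.Splits) (k : ℕ) :
    (derivative^[k] p).Splits := by
  induction k with
  | zero => exact hp
  | succ k ih =>
    rw [Function.iterate_succ_apply']
    exact ih.derivative_real

open Polynomial in
/-- Laguerre's inequality at the origin for a product of real linear factors, in terms of the three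
lowest coefficients. -/
theorem Polynomial.laguerre_inequality_coeff_prod (c : ℝ) (s : Multiset ℝ) :
    2 * s.card * ((C c * (s.map (X + C ·)).prod).coeff 0 *
      (C c * (s.map (X + C ·)).prod).coeff 2) ≤
    (s.card - 1) * (C c * (s.map (X + C ·)).prod).coeff 1 ^ 2 := by
  induction s using Multiset.induction with
  | empty => simp [coeff_C]
  | cons r s ih =>
    rw [Multiset.map_cons, Multiset.prod_cons, mul_left_comm (C c), Multiset.card_cons]
    rcases Nat.eq_zero_or_pos s.card with hs | hs
    · obtain rfl := Multiset.card_eq_zero.mp hs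
      simp [coeff_X, coeff_C]
    · have hd : (0 : ℝ) < s.card := by exact_mod_cast hs
      generalize C c * (s.map (X + C ·)).prod = g at ih ⊢
      simp only [add_mul, coeff_add, coeff_C_mul, coeff_X_mul, coeff_X_mul_zero]
      push_cast
      generalize (s.card : ℝ) = d at ih hd ⊢
      refine le_of_mul_le_mul_left ?_ hd
      nlinarith [mul_le_mul_of_nonneg_left ih (by positivity : 0 ≤ (d + 1) * r ^ 2),
        sq_nonneg (d * g.coeff 0 - r * g.coeff 1)]

open Polynomial in
/-- Laguerre's inequality at the origin for a real-rooted polynomial of degree at most `d`,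
in terms of its three lowest coefficients. -/
theorem Polynomial.Splits.laguerre_inequality_coeff {p : ℝ[X]} (hp : p.Splits) {d : ℕ}
    (hd : p.natDegree ≤ d) :
    2 * d * (p.coeff 0 * p.coeff 2) ≤ (d - 1) * p.coeff 1 ^ 2 := by
  obtain ⟨s, hs⟩ := splits_iff_exists_multiset'.mp hp
  have key := laguerre_inequality_coeff_prod p.leadingCoeff s
  rw [← hs] at key
  by_cases h0 : p = 0
  · simp [h0]
  have hcard : s.card ≤ d := by
    have hc := leadingCoeff_ne_zero.mpr h0
    have h1 : p.natDegree = s.card := by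
      conv_lhs => rw [hs, natDegree_C_mul hc]
      simpa using natDegree_multiset_prod_X_sub_C_eq_card (s.map (- ·))
    omega
  rcases Nat.eq_zero_or_pos s.card with h | h
  · obtain rfl := Multiset.card_eq_zero.mp h
    rw [hs]
    simp [coeff_C]
  · have h1 : (0 : ℝ) < s.card := by exact_mod_cast h
    have h2 : (s.card : ℝ) ≤ d := by exact_mod_cast hcard
    refine le_of_mul_le_mul_left ?_ h1
    nlinarith [mul_le_mul_of_nonneg_left key (h1.le.trans h2),
      mul_nonneg (sub_nonneg.mpr h2) (sq_nonneg (p.coeff 1))]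

theorem Multiset.esymm_cons_succ {R : Type*} [CommSemiring R] (x : R) (s : Multiset R) (j : ℕ) :
    (x ::ₘ s).esymm (j + 1) = s.esymm (j + 1) + x * s.esymm j := by
  simp [Multiset.esymm, Multiset.powersetCard_cons, Multiset.map_map,
    Multiset.sum_map_mul_left]

theorem Multiset.esymm_zero_right {R : Type*} [CommSemiring R] (s : Multiset R) :
    s.esymm 0 = 1 := by
  simp [Multiset.esymm]

theorem Multiset.esymm_one_right {R : Type*} [CommSemiring R] (s : Multiset R) :
    s.esymm 1 = s.sum := by
  simp [Multiset.esymm, Multiset.powersetCard_one, Multiset.map_map]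

theorem Multiset.esymm_eq_zero_of_card_lt {R : Type*} [CommSemiring R] (s : Multiset R) {j : ℕ}
    (h : s.card < j) : s.esymm j = 0 := by
  simp [Multiset.esymm, Multiset.powersetCard_eq_empty j h]

open Polynomial in
/-- Newton's inequality for the elementary symmetric functions of arbitrary real numbers. -/
theorem Multiset.newton_inequality (s : Multiset ℝ) {j N : ℕ} (h : s.card = j + 2 + N) :
    (j + 2) * (N + 2) * (s.esymm j * s.esymm (j + 2)) ≤
      (j + 1) * (N + 1) * s.esymm (j + 1) ^ 2 := by
  have hsplit : (s.map (X + C ·)).prod.Splits :=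
    splits_iff_exists_multiset'.mpr ⟨s, by
      have : (s.map (X + C ·)).prod.Monic :=
        monic_multiset_prod_of_monic _ _ fun r _ => monic_X_add_C r
      rw [this.leadingCoeff, C_1, one_mul]⟩
  have hdeg : (s.map (X + C ·)).prod.natDegree = s.card := by
    simpa using natDegree_multiset_prod_X_sub_C_eq_card (s.map (- ·))
  have key := (hsplit.iterate_derivative_real N).laguerre_inequality_coeff (d := j + 2)
    ((natDegree_iterate_derivative _ N).trans (by omega))
  simp only [coeff_iterate_derivative] at key
  rw [prod_X_add_C_coeff s (by omega), prod_X_add_C_coeff s (by omega),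
    prod_X_add_C_coeff s (by omega), show s.card - (0 + N) = j + 2 by omega,
    show s.card - (1 + N) = j + 1 by omega, show s.card - (2 + N) = j by omega] at key
  have e0 : (0 + N).descFactorial N = N.factorial := by simp [Nat.descFactorial_self]
  have e1 : (1 + N).descFactorial N = (N + 1) * N.factorial := by
    have := Nat.factorial_mul_descFactorial (n := 1 + N) (k := N) (by omega)
    rw [Nat.add_sub_cancel, add_comm 1 N] at this
    rw [add_comm 1 N]
    simpa [Nat.factorial_succ] using this
  have e2 : 2 * (2 + N).descFactorial N = (N + 2) * ((N + 1) * N.factorial) := by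
    have := Nat.factorial_mul_descFactorial (n := 2 + N) (k := N) (by omega)
    rw [Nat.add_sub_cancel, add_comm 2 N] at this
    rw [add_comm 2 N]
    simpa [Nat.factorial_succ] using this
  have e2' : (2 : ℝ) * (2 + N).descFactorial N = (N + 2) * ((N + 1) * N.factorial) := by
    exact_mod_cast e2
  rw [e0, e1] at key
  simp only [nsmul_eq_mul] at key
  push_cast at key
  have hF : (0 : ℝ) < (N + 1) * (N.factorial : ℝ) ^ 2 := by positivity
  refine le_of_mul_le_mul_left ?_ hF
  linear_combination key -
    (j + 2) * N.factorial * s.esymm (j + 2) * s.esymm j * e2'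

/-- Log-concavity of the elementary symmetric functions of real numbers. -/
theorem Multiset.esymm_mul_esymm_le_sq (s : Multiset ℝ) (j : ℕ) :
    s.esymm j * s.esymm (j + 2) ≤ s.esymm (j + 1) ^ 2 := by
  rcases lt_or_ge s.card (j + 2) with h | h
  · rw [s.esymm_eq_zero_of_card_lt h, mul_zero]
    positivity
  · obtain ⟨N, hN⟩ := Nat.exists_eq_add_of_le h
    have key := s.newton_inequality hN
    by_contra! hlt
    have h0 := sq_nonneg (s.esymm (j + 1))
    have hP : (0 : ℝ) < (j + 2) * (N + 2) := by positivity
    have hQ : (0 : ℝ) ≤ (j + 2) * (N + 2) - (j + 1) * (N + 1) := by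
      ring_nf
      positivity
    nlinarith [mul_lt_mul_of_pos_left hlt hP, mul_nonneg hQ h0]

/-- Removing one entry maps the open cone `Γ_{k+1}` to `Γ_k`. -/
theorem Multiset.esymm_pos_of_cons {x : ℝ} {s : Multiset ℝ} {k : ℕ}
    (h : ∀ j ≤ k + 1, 0 < (x ::ₘ s).esymm j) : ∀ j ≤ k, 0 < s.esymm j := by
  induction k with
  | zero =>
    intro j hj
    obtain rfl : j = 0 := by omega
    simp [s.esymm_zero_right]
  | succ k ih =>
    have ih := ih fun j hj => h j (by omega)
    intro j hj
    rcases hj.lt_or_eq with hj | rfl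
    · exact ih j (by omega)
    have h0 := ih k le_rfl
    have h1 := h (k + 1) (by omega)
    have h2 := h (k + 1 + 1) le_rfl
    rw [esymm_cons_succ] at h1 h2
    have h3 := s.esymm_mul_esymm_le_sq k
    by_contra! hneg
    nlinarith [mul_pos h0 h2, mul_nonneg (neg_nonneg.mpr hneg) h1.le]

/-- The Newton–Maclaurin inequality bounding `σ_{j+1} / σ_j` by its value at equal entries. -/
theorem Multiset.maclaurin_ratio {s : Multiset ℝ} {k : ℕ} (hk : k ≤ s.card)
    (h : ∀ j ≤ k, 0 < s.esymm j) {j : ℕ} (hj : j ≤ k) :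
    (j + 1) * s.card * s.esymm (j + 1) ≤ (s.card - j) * (s.esymm 1 * s.esymm j) := by
  induction j with
  | zero => simp [s.esymm_zero_right]
  | succ j ih =>
    have ih := ih (by omega)
    rcases lt_or_ge s.card (j + 2) with hc | hc
    · have hc' : s.card = j + 1 := by omega
      rw [s.esymm_eq_zero_of_card_lt hc, hc']
      simp
    · obtain ⟨N, hN⟩ := Nat.exists_eq_add_of_le hc
      have key := s.newton_inequality hN
      have h0 := h j (by omega)
      have h1 := h (j + 1) hj
      have hm : (s.card : ℝ) = j + 2 + N := by exact_mod_cast hN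
      rw [hm] at ih ⊢
      push_cast
      have hP : 0 < (N + 2) * s.esymm j := by positivity
      refine le_of_mul_le_mul_left ?_ hP
      have hQ : 0 ≤ (N + 1) * s.esymm (j + 1) := by positivity
      nlinarith [mul_le_mul_of_nonneg_left ih hQ,
        mul_le_mul_of_nonneg_left key (by positivity : (0 : ℝ) ≤ j + 2 + N)]

/-- Sharp lower bound for an entry of a vector in the open cone `Γ_{k+1}`. -/
theorem Multiset.cons_lower_bound {x : ℝ} {s : Multiset ℝ} {k : ℕ} (hm : 0 < s.card)
    (hk : k ≤ s.card) (h : ∀ j ≤ k + 1, 0 < (x ::ₘ s).esymm j) :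
    0 < (s.card - k) * s.sum + (k + 1) * s.card * x := by
  have hm : (0 : ℝ) < s.card := by exact_mod_cast hm
  have hs := esymm_pos_of_cons h
  have h1 := maclaurin_ratio hk hs le_rfl
  have h2 := h (k + 1) le_rfl
  rw [esymm_cons_succ] at h2
  rw [esymm_one_right] at h1
  refine pos_of_mul_pos_right ?_ (hs k le_rfl).le
  nlinarith [mul_pos (by positivity : 0 < (k + 1) * (s.card : ℝ)) h2]

open Polynomial in
/-- Translating a point of the closed cone by `ε > 0` moves it into the open cone. -/
theorem Multiset.esymm_map_add_pos {s : Multiset ℝ} {k : ℕ} (hk : k ≤ s.card)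
    (h : ∀ j, 1 ≤ j → j ≤ k → 0 ≤ s.esymm j) {ε : ℝ} (hε : 0 < ε) :
    ∀ j ≤ k, 0 < (s.map (· + ε)).esymm j := by
  intro j hj
  have hdeg : (s.map (X + C ·)).prod.natDegree = s.card := by
    simpa using natDegree_multiset_prod_X_sub_C_eq_card (s.map (- ·))
  have htaylor : ((s.map (· + ε)).map (X + C ·)).prod = taylor ε (s.map (X + C ·)).prod := by
    rw [taylor_apply, multiset_prod_comp, Multiset.map_map, Multiset.map_map]
    congr 1
    refine Multiset.map_congr rfl fun r _ => ?_
    simp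
    ring
  have hcoeff := prod_X_add_C_coeff (s.map (· + ε)) (k := s.card - j) (by simp)
  rw [htaylor, taylor_coeff, card_map, Nat.sub_sub_self (hj.trans hk),
    eval_eq_sum_range' (n := j + 1) ((natDegree_hasseDeriv_le _ _).trans_lt (by omega))] at hcoeff
  rw [← hcoeff]
  simp only [hasseDeriv_coeff]
  refine Finset.sum_pos' (fun i hi => ?_) ⟨j, by simp, ?_⟩
  · rw [Finset.mem_range] at hi
    rw [prod_X_add_C_coeff s (by omega), show s.card - (i + (s.card - j)) = j - i by omega]
    have : 0 ≤ s.esymm (j - i) := by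
      rcases Nat.eq_zero_or_pos (j - i) with h0 | h0
      · simp [h0, s.esymm_zero_right]
      · exact h _ h0 (by omega)
    positivity
  · rw [prod_X_add_C_coeff s (by omega), show s.card - (j + (s.card - j)) = 0 by omega,
      s.esymm_zero_right, mul_one]
    have : 0 < (j + (s.card - j)).choose (s.card - j) := Nat.choose_pos (by omega)
    positivity

/-- Sharp lower bound for an entry of a vector in the closed cone `Γ̄_{k+1}`. -/
theorem Multiset.cons_lower_bound_closed {x : ℝ} {s : Multiset ℝ} {k : ℕ} (hm : 0 < s.card)
    (hk : k ≤ s.card) (h : ∀ j, 1 ≤ j → j ≤ k + 1 → 0 ≤ (x ::ₘ s).esymm j) :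
    0 ≤ (s.card - k) * s.sum + (k + 1) * s.card * x := by
  have hpert : ∀ ε : ℝ, 0 < ε →
      0 < (s.card - k) * (s.sum + s.card * ε) + (k + 1) * s.card * (x + ε) := by
    intro ε hε
    have key := esymm_map_add_pos (by simpa using hk) h hε
    rw [map_cons] at key
    simpa [sum_map_add] using cons_lower_bound (by simpa using hm) (by simpa using hk) key
  have hm : (0 : ℝ) < s.card := by exact_mod_cast hm
  have hk : (k : ℝ) ≤ s.card := by exact_mod_cast hk
  have hB : 0 < (s.card - k) * s.card + (k + 1) * (s.card : ℝ) := by nlinarith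
  by_contra! hneg
  have hε := hpert _ (div_pos (neg_pos.mpr hneg) hB)
  have hdiv := div_mul_cancel₀ (-((s.card - k) * s.sum + (k + 1) * s.card * x)) hB.ne'
  nlinarith

theorem Multiset.esymm_replicate {R : Type*} [CommSemiring R] (m j : ℕ) (a : R) :
    (replicate m a).esymm j = m.choose j * a ^ j := by
  have h : ∀ p ∈ ((replicate m a).powersetCard j).map prod, p = a ^ j := by
    intro p hp
    obtain ⟨t, ht, rfl⟩ := mem_map.mp hp
    obtain ⟨hle, hcard⟩ := mem_powersetCard.mp ht
    rw [eq_replicate_card.mpr fun b hb => eq_of_mem_replicate (mem_of_le hle hb), prod_replicate,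
      hcard]
  rw [esymm, eq_replicate_card.mpr h]
  simp

theorem esymm_eq_multiset_esymm {n : ℕ} (j : ℕ) (Λ : Fin n → ℝ) :
    esymm j Λ = (Finset.univ.val.map Λ).esymm j :=
  (Finset.esymm_map_val Λ _ j).symm

theorem Finset.univ_val_map_eq_cons {ι α : Type*} [Fintype ι] [DecidableEq ι] (f : ι → α) (i : ι) :
    (univ : Finset ι).val.map f = f i ::ₘ (univ.erase i).val.map f := by
  rw [← Multiset.map_cons, erase_val, Multiset.cons_erase (mem_univ_val i)]

/-- The key comparison step: if `S₀` (with `n-1` entries `a` and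
one entry `b`, `a > 0`, `a > b`) lies in `Γ̄ₖ` with `σₖ(S₀) = 0`, then any `S ∈ Γ̄ₖ`
with `σ₁(S) = (n-1)a + b` satisfies `Sᵢ ≥ b` for every `i`. -/
theorem stmt5 {n : ℕ} (hn : 2 ≤ n) (k : ℕ) (hk1 : 2 ≤ k) (hk2 : k ≤ n)
    (a b : ℝ) (ha : 0 < a) (hab : b < a)
    (S₀ : Fin n → ℝ) (hS₀ : S₀ = fun i : Fin n => if (i : ℕ) = n - 1 then b else a)
    (hS₀Γ : ∀ j : ℕ, 1 ≤ j → j ≤ k → 0 ≤ esymm j S₀)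
    (hS₀k : esymm k S₀ = 0)
    (S : Fin n → ℝ)
    (hSΓ : ∀ j : ℕ, 1 ≤ j → j ≤ k → 0 ≤ esymm j S)
    (hS1 : esymm 1 S = (n - 1) * a + b) :
    ∀ i : Fin n, b ≤ S i := by
  intro i
  obtain ⟨m, rfl⟩ : ∃ m, n = m + 1 := ⟨n - 1, by omega⟩
  obtain ⟨k, rfl⟩ : ∃ l, k = l + 1 := ⟨k - 1, by omega⟩
  have hS₀val : Finset.univ.val.map S₀ = b ::ₘ Multiset.replicate m a := by
    rw [Finset.univ_val_map_eq_cons S₀ (Fin.last m)]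
    congr 1
    · simp [hS₀]
    · refine Multiset.eq_replicate.mpr ⟨by simp, fun c hc => ?_⟩
      obtain ⟨j, hj, rfl⟩ := Multiset.mem_map.mp hc
      have hj : j ≠ Fin.last m := Finset.ne_of_mem_erase (Finset.mem_val.mp hj)
      have : (j : ℕ) ≠ m := fun h => hj (Fin.ext h)
      simp [hS₀, this]
  have hb : (k + 1) * b = -((m - k) * a) := by
    rw [esymm_eq_multiset_esymm, hS₀val, Multiset.esymm_cons_succ, Multiset.esymm_replicate,
      Multiset.esymm_replicate] at hS₀k
    have hchoose : (m.choose (k + 1) : ℝ) * (k + 1) = m.choose k * (m - k) := by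
      have := Nat.choose_succ_right_eq m k
      rw [← Nat.cast_sub (by omega : k ≤ m)]
      exact_mod_cast this
    have hpos : (0 : ℝ) < m.choose k * a ^ k := by
      have : 0 < m.choose k := Nat.choose_pos (by omega)
      positivity
    refine mul_left_cancel₀ hpos.ne' ?_
    linear_combination (k + 1) * hS₀k - a ^ (k + 1) * hchoose
  simp only [esymm_eq_multiset_esymm, Finset.univ_val_map_eq_cons S i] at hSΓ hS1
  have hcard : ((Finset.univ.erase i).val.map S).card = m := by simp
  have key := Multiset.cons_lower_bound_closed (by omega) (by omega) hSΓ
  rw [Multiset.esymm_one_right, Multiset.sum_cons] at hS1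
  rw [hcard] at key
  push_cast at hS1
  have hsum : ((Finset.univ.erase i).val.map S).sum = m * a + b - S i := by linarith
  rw [hsum] at key
  have hk : (0 : ℝ) < k := by exact_mod_cast (by omega : 0 < k)
  have hpos : 0 < (m + 1) * (k : ℝ) := by positivity
  have hpos' : 0 < (m + 1) * (k : ℝ) * (k + 1) := by positivity
  refine le_of_mul_le_mul_left ?_ hpos'
  linear_combination (k + 1) * key + (m + 1) * k * hb + (m - k) * hb
end

section
/- Let s₀ ∈ ℝ and let h : [s₀, ∞) → ℝ be differentiable with h(s) ≤ 0 and h'(s) ≤ h(s)²/2 for all s ≥ s₀, and with h(s₀) < 0. Set C = −s₀ − 2/h(s₀) (so that s₀ + C = −2/h(s₀) > 0). Then h(s) ≤ −2/(s + C) for all s ≥ s₀. -/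
open Set

/-- Comparison with the strict supersolution `-k / (s + C)`, `0 < k < 2`, of `y' = y² / 2`. -/
theorem le_neg_div_add_of_deriv_le_sq_div_two {a b k C : ℝ} {h h' : ℝ → ℝ}
    (hderiv : ∀ s ∈ Ici a, HasDerivWithinAt h (h' s) (Ici a) s)
    (hineq : ∀ s ∈ Ici a, h' s ≤ (h s) ^ 2 / 2)
    (hC : 0 < a + C) (ha : h a ≤ -k / (a + C)) (hk : 0 < k) (hk2 : k < 2) (hab : a ≤ b) :
    h b ≤ -k / (b + C) := by
  have hpos : ∀ s, a ≤ s → 0 < s + C := fun s hs => by linarith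
  have hB : ∀ s, a ≤ s → HasDerivAt (fun s => -k / (s + C)) (k / (s + C) ^ 2) s := by
    intro s hs
    have := (hasDerivAt_const s (-k)).fun_div ((hasDerivAt_id' s).add_const C) (hpos s hs).ne'
    simpa using this
  refine image_le_of_deriv_right_lt_deriv_boundary' (a := a) (b := b) (f := h) (f' := h')
    (B := fun s => -k / (s + C)) (B' := fun s => k / (s + C) ^ 2)
    (fun s hs => ((hderiv s hs.1).continuousWithinAt).mono Icc_subset_Ici_self)
    (fun s hs => (hderiv s hs.1).mono (Ici_subset_Ici.2 hs.1)) ha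
    (fun s hs => (hB s hs.1).continuousAt.continuousWithinAt)
    (fun s hs => (hB s hs.1).hasDerivWithinAt) ?_ (right_mem_Icc.2 hab)
  intro s hs heq
  have hs' := hpos s hs.1
  calc h' s ≤ (h s) ^ 2 / 2 := hineq s hs.1
    _ = (k ^ 2 / 2) / (s + C) ^ 2 := by rw [heq, div_pow, neg_sq, div_right_comm]
    _ < k / (s + C) ^ 2 := by
      gcongr
      nlinarith

/-- Riccati comparison: if `h ≤ 0` satisfies `h' ≤ h²/2` on
`[s₀, ∞)` and `h(s₀) < 0`, then with `C = -s₀ - 2/h(s₀)` one has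
`h(s) ≤ -2/(s + C)` for all `s ≥ s₀`. -/
theorem stmt13 (s₀ : ℝ) (h h' : ℝ → ℝ)
    (hderiv : ∀ s ∈ Ici s₀, HasDerivWithinAt h (h' s) (Ici s₀) s)
    (hnonpos : ∀ s ∈ Ici s₀, h s ≤ 0)
    (hineq : ∀ s ∈ Ici s₀, h' s ≤ (h s) ^ 2 / 2)
    (h₀ : h s₀ < 0)
    (C : ℝ) (hC : C = -s₀ - 2 / h s₀) :
    ∀ s ∈ Ici s₀, h s ≤ -2 / (s + C) := by
  intro s hs
  have hs₀ : s₀ + C = -2 / h s₀ := by rw [hC]; ring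
  have hpos₀ : 0 < s₀ + C := hs₀ ▸ div_pos_of_neg_of_neg (by norm_num) h₀
  have hpos : 0 < s + C := by linarith [mem_Ici.1 hs]
  rw [le_div_iff₀ hpos, le_neg]
  refine le_of_forall_lt_imp_le_of_dense fun k hk2 => ?_
  rcases le_or_gt k 0 with hk | hk
  · exact hk.trans (neg_nonneg.2 (mul_nonpos_of_nonpos_of_nonneg (hnonpos s hs) hpos.le))
  · have hinit : h s₀ ≤ -k / (s₀ + C) := by
      rw [le_div_iff₀ hpos₀, hs₀, mul_div_cancel₀ _ h₀.ne]
      linarith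
    have := le_neg_div_add_of_deriv_le_sq_div_two hderiv hineq hpos₀ hinit hk hk2 hs
    rwa [le_div_iff₀ hpos, le_neg] at this
end
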